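/- arXiv:2005.08511 — 3 statements merged into one kernel-verified Lean document; each statement's English description precedes it below -/
import Mathlib

section
/- Let g = icζ/(c²−1) and C = [[1, 0], [g, 1]]. Under the stated hypotheses on the fundamental solutions, the monodromy matrices satisfy F(T;ζ) = e^{gT} · C · H(T;ζ) · C⁻¹; in particular tr F(T;ζ) = e^{gT} · tr H(T;ζ). -/
/-- Zero initial data force the zero solution of a linear second order equation. -/
theorem lin_unique (a : ℂ) (b : ℝ → ℂ) (M : ℝ) (hb : ∀ z, ‖b z‖ ≤ M) (u v : ℝ → ℂ)
    (hu : ∀ z, HasDerivAt u (v z) z)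
    (hv : ∀ z, HasDerivAt v (a * v z + b z * u z) z)
    (hu0 : u 0 = 0) (hv0 : v 0 = 0) (T : ℝ) (hT : 0 < T) : u T = 0 ∧ v T = 0 := by
  have hd : ∀ z, HasDerivAt (fun z => (u z, v z)) (v z, a * v z + b z * u z) z :=
    fun z => (hu z).prodMk (hv z)
  have hM : 0 ≤ M := (norm_nonneg _).trans (hb 0)
  have key : ∀ x ∈ Set.Icc (0 : ℝ) T,
      ‖(u x, v x)‖ ≤ gronwallBound 0 (1 + ‖a‖ + M) 0 (x - 0) := by
    apply norm_le_gronwallBound_of_norm_deriv_right_le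
      (f := fun z => (u z, v z)) (f' := fun z => (v z, a * v z + b z * u z))
    · exact fun z _ => (hd z).continuousAt.continuousWithinAt
    · exact fun z _ => (hd z).hasDerivWithinAt
    · simp [hu0, hv0]
    · intro z _
      have h1 : ‖u z‖ ≤ ‖(u z, v z)‖ := norm_fst_le (u z, v z)
      have h2 : ‖v z‖ ≤ ‖(u z, v z)‖ := norm_snd_le (u z, v z)
      have h3 : 0 ≤ ‖(u z, v z)‖ := norm_nonneg _
      have h4 : ‖a * v z + b z * u z‖ ≤ ‖a‖ * ‖(u z, v z)‖ + M * ‖(u z, v z)‖ := by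
        refine (norm_add_le _ _).trans ?_
        rw [norm_mul, norm_mul]
        have := hb z
        gcongr
      have h5 : 0 ≤ ‖a‖ * ‖(u z, v z)‖ := by positivity
      have h6 : 0 ≤ M * ‖(u z, v z)‖ := by positivity
      rw [add_zero]
      refine norm_prod_le_iff.2 ⟨?_, ?_⟩ <;> dsimp only <;> nlinarith
  have h := key T ⟨hT.le, le_rfl⟩
  rw [gronwallBound_ε0] at h
  have h0 : (u T, v T) = 0 := norm_le_zero_iff.1 (by simpa using h)
  exact Prod.mk_eq_zero.1 h0

/-- with `g = i c ζ / (c² - 1)` and `C = [[1,0],[g,1]]`, the monodromy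
matrices satisfy `F(T;ζ) = e^{gT} • (C * H(T;ζ) * C⁻¹)`; in particular
`tr F(T;ζ) = e^{gT} * tr H(T;ζ)`. -/
theorem monodromy_conjugation
    (c : ℝ) (hc : c ^ 2 ≠ 1) (ζ : ℂ) (U : ℝ → ℝ) (hU : Continuous U)
    (T : ℝ) (hT : 0 < T)
    (g : ℂ) (hg : g = Complex.I * (c : ℂ) * ζ / ((c : ℂ) ^ 2 - 1))
    (p₁ p₂ q₁ q₂ : ℝ → ℂ)
    (hp₁ : Differentiable ℝ p₁) (hp₁' : Differentiable ℝ (deriv p₁))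
    (hp₂ : Differentiable ℝ p₂) (hp₂' : Differentiable ℝ (deriv p₂))
    (hq₁ : Differentiable ℝ q₁) (hq₁' : Differentiable ℝ (deriv q₁))
    (hq₂ : Differentiable ℝ q₂) (hq₂' : Differentiable ℝ (deriv q₂))
    (heqp₁ : ∀ z : ℝ,
      deriv (deriv p₁) z - (2 * Complex.I * (c : ℂ) * ζ / ((c : ℂ) ^ 2 - 1)) * deriv p₁ z
        + (-ζ ^ 2 / ((c : ℂ) ^ 2 - 1) + (Real.cos (U z) : ℂ) / ((c : ℂ) ^ 2 - 1)) * p₁ z = 0)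
    (heqp₂ : ∀ z : ℝ,
      deriv (deriv p₂) z - (2 * Complex.I * (c : ℂ) * ζ / ((c : ℂ) ^ 2 - 1)) * deriv p₂ z
        + (-ζ ^ 2 / ((c : ℂ) ^ 2 - 1) + (Real.cos (U z) : ℂ) / ((c : ℂ) ^ 2 - 1)) * p₂ z = 0)
    (heqq₁ : ∀ z : ℝ,
      deriv (deriv q₁) z
        + (ζ ^ 2 / ((c : ℂ) ^ 2 - 1) ^ 2 + (Real.cos (U z) : ℂ) / ((c : ℂ) ^ 2 - 1)) * q₁ z = 0)
    (heqq₂ : ∀ z : ℝ,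
      deriv (deriv q₂) z
        + (ζ ^ 2 / ((c : ℂ) ^ 2 - 1) ^ 2 + (Real.cos (U z) : ℂ) / ((c : ℂ) ^ 2 - 1)) * q₂ z = 0)
    (hp₁0 : p₁ 0 = 1) (hp₁0' : deriv p₁ 0 = 0)
    (hp₂0 : p₂ 0 = 0) (hp₂0' : deriv p₂ 0 = 1)
    (hq₁0 : q₁ 0 = 1) (hq₁0' : deriv q₁ 0 = 0)
    (hq₂0 : q₂ 0 = 0) (hq₂0' : deriv q₂ 0 = 1)
    (F H C : Matrix (Fin 2) (Fin 2) ℂ)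
    (hF : F = !![p₁ T, p₂ T; deriv p₁ T, deriv p₂ T])
    (hH : H = !![q₁ T, q₂ T; deriv q₁ T, deriv q₂ T])
    (hC : C = !![1, 0; g, 1]) :
    F = Complex.exp (g * (T : ℂ)) • (C * H * C⁻¹)
    ∧ Matrix.trace F = Complex.exp (g * (T : ℂ)) * Matrix.trace H := by
  have hc0 : (c : ℂ) ^ 2 - 1 ≠ 0 := by
    rw [sub_ne_zero]
    exact_mod_cast hc
  -- comparison of an LSG solution with the transform of a Hill solution
  have main : ∀ p q : ℝ → ℂ, Differentiable ℝ p → Differentiable ℝ (deriv p) →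
      ∀ q' : ℝ → ℂ, (∀ z, HasDerivAt q (q' z) z) →
      (∀ z, HasDerivAt q' (-(ζ ^ 2 / ((c : ℂ) ^ 2 - 1) ^ 2
        + (Real.cos (U z) : ℂ) / ((c : ℂ) ^ 2 - 1)) * q z) z) →
      (∀ z : ℝ,
        deriv (deriv p) z - (2 * Complex.I * (c : ℂ) * ζ / ((c : ℂ) ^ 2 - 1)) * deriv p z
        + (-ζ ^ 2 / ((c : ℂ) ^ 2 - 1) + (Real.cos (U z) : ℂ) / ((c : ℂ) ^ 2 - 1)) * p z = 0) →
      p 0 = q 0 → deriv p 0 = q' 0 + g * q 0 →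
      p T = Complex.exp (g * T) * q T ∧
      deriv p T = Complex.exp (g * T) * (q' T + g * q T) := by
    intro p q hp hp' q' hq hq' hode h0 h0'
    have hE : ∀ z : ℝ, HasDerivAt (fun z : ℝ => Complex.exp (g * z))
        (Complex.exp (g * z) * g) z := by
      intro z
      have := ((Complex.ofRealCLM.hasDerivAt (x := z)).const_mul g).cexp
      simpa using this
    have := lin_unique (2 * g) (fun z => -(-ζ ^ 2 / ((c : ℂ) ^ 2 - 1)
        + (Real.cos (U z) : ℂ) / ((c : ℂ) ^ 2 - 1)))
      (‖-ζ ^ 2 / ((c : ℂ) ^ 2 - 1)‖ + 1 / ‖(c : ℂ) ^ 2 - 1‖) ?_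
      (fun z => p z - Complex.exp (g * z) * q z)
      (fun z => deriv p z - Complex.exp (g * z) * (q' z + g * q z)) ?_ ?_ ?_ ?_ T hT
    · exact ⟨sub_eq_zero.1 this.1, sub_eq_zero.1 this.2⟩
    · intro z
      rw [norm_neg]
      refine (norm_add_le _ _).trans ?_
      rw [norm_div (Real.cos (U z) : ℂ), Complex.norm_real]
      have := Real.abs_cos_le_one (U z)
      rw [Real.norm_eq_abs]
      gcongr
    · intro z
      refine ((hp z).hasDerivAt.sub ((hE z).mul (hq z))).congr_deriv ?_
      ring
    · intro z
      refine ((hp' z).hasDerivAt.sub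
        ((hE z).mul ((hq' z).add ((hq z).const_mul g)))).congr_deriv ?_
      have h2 : deriv (deriv p) z = 2 * g * deriv p z
        - (-ζ ^ 2 / ((c : ℂ) ^ 2 - 1) + (Real.cos (U z) : ℂ) / ((c : ℂ) ^ 2 - 1)) * p z := by
        rw [hg]
        linear_combination hode z
      have h3 : g ^ 2 = -ζ ^ 2 / ((c : ℂ) ^ 2 - 1) - ζ ^ 2 / ((c : ℂ) ^ 2 - 1) ^ 2 := by
        rw [hg]
        field_simp
        rw [Complex.I_sq]
        ring
      rw [h2]
      simp only [Pi.add_apply]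
      linear_combination (Complex.exp (g * z) * q z) * h3
    · simp [h0]
    · simp [h0']
  have hd : ∀ q : ℝ → ℂ, Differentiable ℝ (deriv q) → (∀ z : ℝ,
      deriv (deriv q) z
        + (ζ ^ 2 / ((c : ℂ) ^ 2 - 1) ^ 2 + (Real.cos (U z) : ℂ) / ((c : ℂ) ^ 2 - 1)) * q z = 0) →
      ∀ z, HasDerivAt (deriv q) (-(ζ ^ 2 / ((c : ℂ) ^ 2 - 1) ^ 2
        + (Real.cos (U z) : ℂ) / ((c : ℂ) ^ 2 - 1)) * q z) z := by
    intro q hq hode z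
    refine (hq z).hasDerivAt.congr_deriv ?_
    linear_combination hode z
  obtain ⟨e2, e2'⟩ := main p₂ q₂ hp₂ hp₂' (deriv q₂) (fun z => (hq₂ z).hasDerivAt)
    (hd q₂ hq₂' heqq₂) heqp₂ (by rw [hp₂0, hq₂0]) (by rw [hp₂0', hq₂0', hq₂0]; ring)
  obtain ⟨e1, e1'⟩ := main p₁ (fun z => q₁ z - g * q₂ z) hp₁ hp₁'
    (fun z => deriv q₁ z - g * deriv q₂ z)
    (fun z => (hq₁ z).hasDerivAt.sub ((hq₂ z).hasDerivAt.const_mul g))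
    (fun z => ((hd q₁ hq₁' heqq₁ z).sub ((hd q₂ hq₂' heqq₂ z).const_mul g)).congr_deriv
      (by ring)) heqp₁ (by simp [hp₁0, hq₁0, hq₂0]) (by simp [hp₁0', hq₁0, hq₂0, hq₁0', hq₂0'])
  have hCi : C⁻¹ = !![1, 0; -g, 1] := by
    apply Matrix.inv_eq_right_inv
    rw [hC, Matrix.mul_fin_two, Matrix.one_fin_two]
    simp
  constructor
  · rw [hCi, hF, hH, hC, Matrix.mul_fin_two, Matrix.mul_fin_two, e1, e1', e2, e2']
    ext i j
    fin_cases i <;> fin_cases j <;> simp <;> ring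
  · rw [hF, hH, Matrix.trace_fin_two_of, Matrix.trace_fin_two_of, e1, e2']
    ring
end

section
/- Under the stated hypotheses on the fundamental solutions, a complex number η is an eigenvalue of the Hill monodromy matrix H(T;ζ) if and only if exp(icζT/(c²−1))·η is an eigenvalue of the monodromy matrix F(T;ζ) of the linearised sine-Gordon equation. -/
/-- The Wronskian of two solutions of Hill equations is constant. -/
lemma wronskian_const (f f' g g' Q : ℝ → ℂ)
    (hf : ∀ z, HasDerivAt f (f' z) z) (hf' : ∀ z, HasDerivAt f' (-(Q z * f z)) z)
    (hg : ∀ z, HasDerivAt g (g' z) z) (hg' : ∀ z, HasDerivAt g' (-(Q z * g z)) z) (T : ℝ) :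
    f T * g' T - f' T * g T = f 0 * g' 0 - f' 0 * g 0 := by
  have h : ∀ z, HasDerivAt (fun z => f z * g' z - f' z * g z) 0 z := by
    intro z
    have h1 := ((hf z).mul (hg' z)).sub ((hf' z).mul (hg z))
    refine h1.congr_deriv ?_
    ring
  exact is_const_of_deriv_eq_zero (fun z => (h z).differentiableAt) (fun z => (h z).deriv) T 0

/-- Every solution of the Hill equation is a combination of the fundamental solutions. -/
lemma hill_rep (f f' g g' r r' Q : ℝ → ℂ)
    (hf : ∀ z, HasDerivAt f (f' z) z) (hf' : ∀ z, HasDerivAt f' (-(Q z * f z)) z)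
    (hg : ∀ z, HasDerivAt g (g' z) z) (hg' : ∀ z, HasDerivAt g' (-(Q z * g z)) z)
    (hr : ∀ z, HasDerivAt r (r' z) z) (hr' : ∀ z, HasDerivAt r' (-(Q z * r z)) z)
    (f0 : f 0 = 1) (f0' : f' 0 = 0) (g0 : g 0 = 0) (g0' : g' 0 = 1) (T : ℝ) :
    r T = r 0 * f T + r' 0 * g T ∧ r' T = r 0 * f' T + r' 0 * g' T := by
  have h1 := wronskian_const f f' g g' Q hf hf' hg hg' T
  have h2 := wronskian_const r r' f f' Q hr hr' hf hf' T
  have h3 := wronskian_const r r' g g' Q hr hr' hg hg' T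
  rw [f0, f0', g0, g0'] at h1
  rw [f0, f0'] at h2
  rw [g0, g0'] at h3
  constructor
  · linear_combination (-r T) * h1 - g T * h2 + f T * h3
  · linear_combination (-r' T) * h1 - g' T * h2 + f' T * h3

/-- The gauge transformation `p = exp(a z) r` from (LSG) to Hill, and the resulting formula. -/
lemma lsg_rep (a : ℂ) (p f g Q B : ℝ → ℂ)
    (hp : Differentiable ℝ p) (hp' : Differentiable ℝ (deriv p))
    (hf : ∀ z, HasDerivAt f (deriv f z) z) (hf' : ∀ z, HasDerivAt (deriv f) (-(Q z * f z)) z)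
    (hg : ∀ z, HasDerivAt g (deriv g z) z) (hg' : ∀ z, HasDerivAt (deriv g) (-(Q z * g z)) z)
    (f0 : f 0 = 1) (f0' : deriv f 0 = 0) (g0 : g 0 = 0) (g0' : deriv g 0 = 1)
    (hB : ∀ z, B z = Q z + a ^ 2)
    (heq : ∀ z, deriv (deriv p) z - 2 * a * deriv p z + B z * p z = 0) (T : ℝ) :
    p T = Complex.exp (a * T) * (p 0 * f T + (deriv p 0 - a * p 0) * g T) ∧
    deriv p T = Complex.exp (a * T) * (p 0 * deriv f T + (deriv p 0 - a * p 0) * deriv g T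
      + a * (p 0 * f T + (deriv p 0 - a * p 0) * g T)) := by
  have he : ∀ z : ℝ, HasDerivAt (fun z : ℝ => Complex.exp (-(a * z)))
      (Complex.exp (-(a * z)) * (-(a * 1))) z := by
    intro z
    exact (((Complex.ofRealCLM.hasDerivAt (x := z)).const_mul a).neg).cexp
  have hr : ∀ z : ℝ, HasDerivAt (fun z : ℝ => Complex.exp (-(a * z)) * p z)
      (Complex.exp (-(a * z)) * (deriv p z - a * p z)) z := by
    intro z
    refine ((he z).mul (hp z).hasDerivAt).congr_deriv ?_
    ring
  have hr' : ∀ z : ℝ, HasDerivAt (fun z : ℝ => Complex.exp (-(a * z)) * (deriv p z - a * p z))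
      (-(Q z * (Complex.exp (-(a * z)) * p z))) z := by
    intro z
    refine ((he z).mul ((hp' z).hasDerivAt.sub ((hp z).hasDerivAt.const_mul a))).congr_deriv ?_
    simp only [Pi.sub_apply]
    linear_combination Complex.exp (-(a * z)) * heq z - Complex.exp (-(a * z)) * p z * hB z
  obtain ⟨h1, h2⟩ := hill_rep f (deriv f) g (deriv g) _ _ Q hf hf' hg hg' hr hr' f0 f0' g0 g0' T
  simp only [Complex.ofReal_zero, mul_zero, neg_zero, Complex.exp_zero, one_mul] at h1 h2
  have hE : Complex.exp (a * T) * Complex.exp (-(a * T)) = 1 := by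
    rw [← Complex.exp_add]; simp
  constructor
  · linear_combination (-p T) * hE + Complex.exp (a * T) * h1
  · linear_combination (-deriv p T) * hE + Complex.exp (a * T) * h2 + a * Complex.exp (a * T) * h1

/-- `η` is an eigenvalue of the Hill monodromy matrix `H(T;ζ)` iff
`exp(i c ζ T / (c² - 1)) * η` is an eigenvalue of the (LSG) monodromy matrix `F(T;ζ)`. -/
theorem hill_lsg_eigenvalue_correspondence
    (c : ℝ) (hc : c ^ 2 ≠ 1) (ζ : ℂ) (U : ℝ → ℝ) (hU : Continuous U)
    (T : ℝ) (hT : 0 < T)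
    (p₁ p₂ q₁ q₂ : ℝ → ℂ)
    (hp₁ : Differentiable ℝ p₁) (hp₁' : Differentiable ℝ (deriv p₁))
    (hp₂ : Differentiable ℝ p₂) (hp₂' : Differentiable ℝ (deriv p₂))
    (hq₁ : Differentiable ℝ q₁) (hq₁' : Differentiable ℝ (deriv q₁))
    (hq₂ : Differentiable ℝ q₂) (hq₂' : Differentiable ℝ (deriv q₂))
    (heqp₁ : ∀ z : ℝ,
      deriv (deriv p₁) z - (2 * Complex.I * (c : ℂ) * ζ / ((c : ℂ) ^ 2 - 1)) * deriv p₁ z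
        + (-ζ ^ 2 / ((c : ℂ) ^ 2 - 1) + (Real.cos (U z) : ℂ) / ((c : ℂ) ^ 2 - 1)) * p₁ z = 0)
    (heqp₂ : ∀ z : ℝ,
      deriv (deriv p₂) z - (2 * Complex.I * (c : ℂ) * ζ / ((c : ℂ) ^ 2 - 1)) * deriv p₂ z
        + (-ζ ^ 2 / ((c : ℂ) ^ 2 - 1) + (Real.cos (U z) : ℂ) / ((c : ℂ) ^ 2 - 1)) * p₂ z = 0)
    (heqq₁ : ∀ z : ℝ,
      deriv (deriv q₁) z
        + (ζ ^ 2 / ((c : ℂ) ^ 2 - 1) ^ 2 + (Real.cos (U z) : ℂ) / ((c : ℂ) ^ 2 - 1)) * q₁ z = 0)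
    (heqq₂ : ∀ z : ℝ,
      deriv (deriv q₂) z
        + (ζ ^ 2 / ((c : ℂ) ^ 2 - 1) ^ 2 + (Real.cos (U z) : ℂ) / ((c : ℂ) ^ 2 - 1)) * q₂ z = 0)
    (hp₁0 : p₁ 0 = 1) (hp₁0' : deriv p₁ 0 = 0)
    (hp₂0 : p₂ 0 = 0) (hp₂0' : deriv p₂ 0 = 1)
    (hq₁0 : q₁ 0 = 1) (hq₁0' : deriv q₁ 0 = 0)
    (hq₂0 : q₂ 0 = 0) (hq₂0' : deriv q₂ 0 = 1)
    (F H : Matrix (Fin 2) (Fin 2) ℂ)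
    (hF : F = !![p₁ T, p₂ T; deriv p₁ T, deriv p₂ T])
    (hH : H = !![q₁ T, q₂ T; deriv q₁ T, deriv q₂ T])
    (η : ℂ) :
    (∃ v : Fin 2 → ℂ, v ≠ 0 ∧ H.mulVec v = η • v)
    ↔ (∃ w : Fin 2 → ℂ, w ≠ 0 ∧
        F.mulVec w = (Complex.exp (Complex.I * (c : ℂ) * ζ * (T : ℂ) / ((c : ℂ) ^ 2 - 1)) * η) • w) := by
  have hd : (c : ℂ) ^ 2 - 1 ≠ 0 := by
    rw [sub_ne_zero]; exact_mod_cast hc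
  set d : ℂ := (c : ℂ) ^ 2 - 1 with hd_def
  have hc2 : (c : ℂ) ^ 2 = d + 1 := by rw [hd_def]; ring
  obtain ⟨a, ha⟩ : ∃ a : ℂ, a = Complex.I * (c : ℂ) * ζ / d := ⟨_, rfl⟩
  have hB : ∀ z : ℝ, -ζ ^ 2 / d + (Real.cos (U z) : ℂ) / d
      = (ζ ^ 2 / d ^ 2 + (Real.cos (U z) : ℂ) / d) + a ^ 2 := by
    intro z
    have : a ^ 2 = -(d + 1) * ζ ^ 2 / d ^ 2 := by
      rw [ha, div_pow, mul_pow, mul_pow, Complex.I_sq, hc2]; ring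
    rw [this]; field_simp; ring
  have h2a : 2 * Complex.I * (c : ℂ) * ζ / d = 2 * a := by rw [ha]; ring
  have hexp : Complex.I * (c : ℂ) * ζ * (T : ℂ) / d = a * T := by rw [ha]; ring
  rw [h2a] at heqp₁ heqp₂
  rw [hexp]
  have hq₁'' : ∀ z, HasDerivAt (deriv q₁)
      (-((fun z : ℝ => ζ ^ 2 / d ^ 2 + (Real.cos (U z) : ℂ) / d) z * q₁ z)) z := fun z =>
    (hq₁' z).hasDerivAt.congr_deriv (by linear_combination heqq₁ z)
  have hq₂'' : ∀ z, HasDerivAt (deriv q₂)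
      (-((fun z : ℝ => ζ ^ 2 / d ^ 2 + (Real.cos (U z) : ℂ) / d) z * q₂ z)) z := fun z =>
    (hq₂' z).hasDerivAt.congr_deriv (by linear_combination heqq₂ z)
  obtain ⟨e1, e1'⟩ := lsg_rep a p₁ q₁ q₂ _ _ hp₁ hp₁' (fun z => (hq₁ z).hasDerivAt) hq₁''
    (fun z => (hq₂ z).hasDerivAt) hq₂'' hq₁0 hq₁0' hq₂0 hq₂0' hB heqp₁ T
  obtain ⟨e2, e2'⟩ := lsg_rep a p₂ q₁ q₂ _ _ hp₂ hp₂' (fun z => (hq₁ z).hasDerivAt) hq₁''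
    (fun z => (hq₂ z).hasDerivAt) hq₂'' hq₁0 hq₁0' hq₂0 hq₂0' hB heqp₂ T
  rw [hp₁0, hp₁0'] at e1 e1'
  rw [hp₂0, hp₂0'] at e2 e2'
  have hE : Complex.exp (a * T) ≠ 0 := Complex.exp_ne_zero _
  generalize Complex.exp (a * T) = E at *
  subst hF hH
  rw [e1, e1', e2, e2']
  constructor
  · rintro ⟨v, hv, h⟩
    have h0 := congrFun h 0
    have h1 := congrFun h 1
    simp [Matrix.mulVec, dotProduct, Fin.sum_univ_two] at h0 h1
    refine ⟨![v 0, a * v 0 + v 1], ?_, ?_⟩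
    · intro hw
      apply hv
      have w0 := congrFun hw 0
      have w1 := congrFun hw 1
      simp at w0 w1
      ext i
      fin_cases i
      · simpa using w0
      · simpa [w0] using w1
    · ext i
      fin_cases i
      · simp [Matrix.mulVec, dotProduct, Fin.sum_univ_two]
        linear_combination E * h0
      · simp [Matrix.mulVec, dotProduct, Fin.sum_univ_two]
        linear_combination E * h1 + a * E * h0
  · rintro ⟨w, hw, h⟩
    have h0 := congrFun h 0
    have h1 := congrFun h 1
    simp [Matrix.mulVec, dotProduct, Fin.sum_univ_two] at h0 h1
    refine ⟨![w 0, w 1 - a * w 0], ?_, ?_⟩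
    · intro hv
      apply hw
      have w0 := congrFun hv 0
      have w1 := congrFun hv 1
      simp at w0 w1
      ext i
      fin_cases i
      · simpa using w0
      · simpa [w0] using w1
    · ext i
      fin_cases i
      · simp [Matrix.mulVec, dotProduct, Fin.sum_univ_two]
        apply mul_left_cancel₀ hE
        linear_combination h0
      · simp [Matrix.mulVec, dotProduct, Fin.sum_univ_two]
        apply mul_left_cancel₀ hE
        linear_combination h1 - a * h0
end

section
/- Under the stated hypotheses on the fundamental solutions, for every θ ∈ ℝ the two Evans functions satisfy the identity D₁(ζ;θ) = −exp(icζT/(c²−1) − iθ) · D₂(ζ;θ), where D₁(ζ;θ) = det(F(T;ζ) − e^{−iθ}I) and D₂(ζ;θ) = tr(H(T;ζ)) − 2cos(cζT/(c²−1) + θ), with cos the complex cosine. -/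
lemma evans_wronskian_aux (a : ℂ) (p q : ℝ → ℂ) (V K : ℝ → ℂ)
    (hp : Differentiable ℝ p) (hp' : Differentiable ℝ (deriv p))
    (hq : Differentiable ℝ q) (hq' : Differentiable ℝ (deriv q))
    (h1 : ∀ z, deriv (deriv p) z - 2 * a * deriv p z + V z * p z = 0)
    (h2 : ∀ z, deriv (deriv q) z + K z * q z = 0)
    (hV : ∀ z, V z = K z + a ^ 2) (z : ℝ) :
    p z * deriv q z + a * p z * q z - deriv p z * q z
      = Complex.exp (a * (z : ℂ)) * (p 0 * deriv q 0 + a * p 0 * q 0 - deriv p 0 * q 0) := by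
  have hd : ∀ x : ℝ, HasDerivAt (fun y : ℝ => Complex.exp (-a * (y : ℂ)) *
      (p y * deriv q y + a * p y * q y - deriv p y * q y)) 0 x := by
    intro x
    have e1 : HasDerivAt (fun y : ℝ => Complex.exp (-a * (y : ℂ)))
        (Complex.exp (-a * (x : ℂ)) * (-a * 1)) x :=
      (((hasDerivAt_id (x : ℂ)).const_mul (-a)).cexp).comp_ofReal
    have dp := (hp x).hasDerivAt
    have dp' := (hp' x).hasDerivAt
    have dq := (hq x).hasDerivAt
    have dq' := (hq' x).hasDerivAt
    have := e1.mul (((dp.mul dq').add ((dp.const_mul a).mul dq)).sub (dp'.mul dq))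
    refine this.congr_deriv ?_
    simp only [Pi.add_apply, Pi.sub_apply, Pi.mul_apply]
    have k1 := h1 x
    have k2 := h2 x
    rw [hV x] at k1
    linear_combination Complex.exp (-a * (x : ℂ)) * (p x * k2 - q x * k1)
  have hc := is_const_of_deriv_eq_zero (fun x => (hd x).differentiableAt)
    (fun x => (hd x).deriv) z 0
  simp only [Complex.ofReal_zero, mul_zero, Complex.exp_zero, one_mul] at hc
  rw [← hc, ← mul_assoc, ← Complex.exp_add]
  simp

/-- the two Evans functions satisfy
`D₁(ζ;θ) = -exp(icζT/(c²-1) - iθ) * D₂(ζ;θ)`, where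
`D₁(ζ;θ) = det(F(T;ζ) - e^{-iθ} I)` and
`D₂(ζ;θ) = tr H(T;ζ) - 2 cos(cζT/(c²-1) + θ)`. -/
theorem evans_D1_eq_D2
    (c : ℝ) (hc : c ^ 2 ≠ 1) (ζ : ℂ) (U : ℝ → ℝ) (hU : Continuous U)
    (T : ℝ) (hT : 0 < T)
    (p₁ p₂ q₁ q₂ : ℝ → ℂ)
    (hp₁ : Differentiable ℝ p₁) (hp₁' : Differentiable ℝ (deriv p₁))
    (hp₂ : Differentiable ℝ p₂) (hp₂' : Differentiable ℝ (deriv p₂))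
    (hq₁ : Differentiable ℝ q₁) (hq₁' : Differentiable ℝ (deriv q₁))
    (hq₂ : Differentiable ℝ q₂) (hq₂' : Differentiable ℝ (deriv q₂))
    (heqp₁ : ∀ z : ℝ,
      deriv (deriv p₁) z - (2 * Complex.I * (c : ℂ) * ζ / ((c : ℂ) ^ 2 - 1)) * deriv p₁ z
        + (-ζ ^ 2 / ((c : ℂ) ^ 2 - 1) + (Real.cos (U z) : ℂ) / ((c : ℂ) ^ 2 - 1)) * p₁ z = 0)
    (heqp₂ : ∀ z : ℝ,
      deriv (deriv p₂) z - (2 * Complex.I * (c : ℂ) * ζ / ((c : ℂ) ^ 2 - 1)) * deriv p₂ z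
        + (-ζ ^ 2 / ((c : ℂ) ^ 2 - 1) + (Real.cos (U z) : ℂ) / ((c : ℂ) ^ 2 - 1)) * p₂ z = 0)
    (heqq₁ : ∀ z : ℝ,
      deriv (deriv q₁) z
        + (ζ ^ 2 / ((c : ℂ) ^ 2 - 1) ^ 2 + (Real.cos (U z) : ℂ) / ((c : ℂ) ^ 2 - 1)) * q₁ z = 0)
    (heqq₂ : ∀ z : ℝ,
      deriv (deriv q₂) z
        + (ζ ^ 2 / ((c : ℂ) ^ 2 - 1) ^ 2 + (Real.cos (U z) : ℂ) / ((c : ℂ) ^ 2 - 1)) * q₂ z = 0)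
    (hp₁0 : p₁ 0 = 1) (hp₁0' : deriv p₁ 0 = 0)
    (hp₂0 : p₂ 0 = 0) (hp₂0' : deriv p₂ 0 = 1)
    (hq₁0 : q₁ 0 = 1) (hq₁0' : deriv q₁ 0 = 0)
    (hq₂0 : q₂ 0 = 0) (hq₂0' : deriv q₂ 0 = 1)
    (F H : Matrix (Fin 2) (Fin 2) ℂ)
    (hF : F = !![p₁ T, p₂ T; deriv p₁ T, deriv p₂ T])
    (hH : H = !![q₁ T, q₂ T; deriv q₁ T, deriv q₂ T]) :
    ∀ θ : ℝ,
      Matrix.det (F - Complex.exp (-Complex.I * (θ : ℂ)) • (1 : Matrix (Fin 2) (Fin 2) ℂ))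
        = -Complex.exp (Complex.I * (c : ℂ) * ζ * (T : ℂ) / ((c : ℂ) ^ 2 - 1) - Complex.I * (θ : ℂ))
          * (Matrix.trace H
              - 2 * Complex.cos ((c : ℂ) * ζ * (T : ℂ) / ((c : ℂ) ^ 2 - 1) + (θ : ℂ))) := by
  have hc' : (c : ℂ) ^ 2 - 1 ≠ 0 := by
    intro h
    apply hc
    have : (c : ℂ) ^ 2 = 1 := by linear_combination h
    exact_mod_cast this
  intro θ
  obtain ⟨a, ha⟩ : ∃ a : ℂ, a = Complex.I * (c : ℂ) * ζ / ((c : ℂ) ^ 2 - 1) := ⟨_, rfl⟩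
  have ha2 : (2 * Complex.I * (c : ℂ) * ζ / ((c : ℂ) ^ 2 - 1)) = 2 * a := by rw [ha]; ring
  simp only [ha2] at heqp₁ heqp₂
  have hV : ∀ z : ℝ, -ζ ^ 2 / ((c : ℂ) ^ 2 - 1) + (Real.cos (U z) : ℂ) / ((c : ℂ) ^ 2 - 1)
      = (ζ ^ 2 / ((c : ℂ) ^ 2 - 1) ^ 2 + (Real.cos (U z) : ℂ) / ((c : ℂ) ^ 2 - 1)) + a ^ 2 := by
    intro z
    rw [ha, div_pow, mul_pow, mul_pow, Complex.I_sq]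
    field_simp
    ring
  have w1 := evans_wronskian_aux a p₁ q₁ _ _ hp₁ hp₁' hq₁ hq₁' heqp₁ heqq₁ hV T
  have w2 := evans_wronskian_aux a p₁ q₂ _ _ hp₁ hp₁' hq₂ hq₂' heqp₁ heqq₂ hV T
  have w3 := evans_wronskian_aux a p₂ q₁ _ _ hp₂ hp₂' hq₁ hq₁' heqp₂ heqq₁ hV T
  have w4 := evans_wronskian_aux a p₂ q₂ _ _ hp₂ hp₂' hq₂ hq₂' heqp₂ heqq₂ hV T
  have w5 := evans_wronskian_aux 0 q₁ q₂
    (fun z => ζ ^ 2 / ((c : ℂ) ^ 2 - 1) ^ 2 + (Real.cos (U z) : ℂ) / ((c : ℂ) ^ 2 - 1)) _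
    hq₁ hq₁' hq₂ hq₂' (fun z => by simpa using heqq₁ z) heqq₂ (fun z => by simp) T
  simp only [hp₁0, hp₁0', hp₂0, hp₂0', hq₁0, hq₁0', hq₂0, hq₂0', zero_mul, mul_zero, mul_one,
    one_mul, add_zero, zero_add, sub_zero, zero_sub, Complex.exp_zero] at w1 w2 w3 w4 w5
  have c1 : Complex.I * (c : ℂ) * ζ * (T : ℂ) / ((c : ℂ) ^ 2 - 1) = a * T := by rw [ha]; ring
  have c2 : ((c : ℂ) * ζ * (T : ℂ) / ((c : ℂ) ^ 2 - 1) + (θ : ℂ)) * Complex.I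
      = a * T + Complex.I * θ := by rw [ha]; ring
  have c3 : -((c : ℂ) * ζ * (T : ℂ) / ((c : ℂ) ^ 2 - 1) + (θ : ℂ)) * Complex.I
      = -(a * T) + -Complex.I * θ := by rw [ha]; ring
  have c4 : a * T - Complex.I * θ = a * T + -Complex.I * θ := by ring
  have m1 : Complex.exp (a * T) * Complex.exp (-(a * T)) = 1 := by
    rw [← Complex.exp_add]; simp
  have m2 : Complex.exp (Complex.I * θ) * Complex.exp (-Complex.I * θ) = 1 := by
    rw [← Complex.exp_add]; simp
  rw [hF, hH, Complex.cos, c2, c3, c1, c4, Complex.exp_add, Complex.exp_add, Complex.exp_add,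
    Matrix.det_fin_two, Matrix.trace_fin_two]
  simp only [Matrix.sub_apply, Matrix.smul_apply, Matrix.of_apply, Matrix.cons_val', 
    Matrix.cons_val_zero, Matrix.cons_val_one, Matrix.one_apply, smul_eq_mul]
  simp only [Fin.isValue, if_true, Fin.reduceEq, if_false, mul_one, mul_zero, sub_zero, Matrix.cons_val_fin_one]
  generalize Complex.exp (a * T) = e at *
  generalize Complex.exp (-(a * T)) = E at *
  generalize Complex.exp (-Complex.I * θ) = m at *
  generalize Complex.exp (Complex.I * θ) = M at *
  have s1 : p₁ T = e * (q₁ T - a * q₂ T) := by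
    linear_combination q₁ T * w2 - q₂ T * w1 - p₁ T * w5
  have s2 : p₂ T = e * q₂ T := by
    linear_combination q₁ T * w4 - q₂ T * w3 - p₂ T * w5
  have s3 : deriv p₁ T = e * (deriv q₁ T - a * deriv q₂ T) + a * p₁ T := by
    linear_combination deriv q₁ T * w2 - deriv q₂ T * w1 - (deriv p₁ T - a * p₁ T) * w5
  have s4 : deriv p₂ T = e * deriv q₂ T + a * p₂ T := by
    linear_combination deriv q₁ T * w4 - deriv q₂ T * w3 - (deriv p₂ T - a * p₂ T) * w5
  rw [s3, s4, s1, s2]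
  linear_combination e ^ 2 * w5 - e ^ 2 * m2 - m ^ 2 * m1
end
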